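/- Every automorphism φ of W(2) leaves the subspaces S₂ and W₂ invariant, i.e., φ(S₂) ⊆ S₂ and φ(W₂) ⊆ W₂. -/

import Mathlib

set_option maxSynthPendingDepth 3

/-- The 2-dimensional vector space `V₂ = F²`, with standard basis `v₁ = (1,0)`, `v₂ = (0,1)`. -/
abbrev V2 (F : Type*) [Field F] := Fin 2 → F

/-- The fixed vector `v₁` (the first standard basis vector of `V₂`). -/
noncomputable def v1 (F : Type*) [Field F] : V2 F := Pi.single 0 1

/-- `W(2)`: the space of all bilinear multiplications on `V₂`. -/
abbrev Wtwo (F : Type*) [Field F] := V2 F →ₗ[F] V2 F →ₗ[F] V2 F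

variable {F : Type*} [Field F]

/-- The Kantor product on `W(2)`:
`(A·B)(x,y) = A(v₁, B(x,y)) − B(A(v₁,x), y) − B(x, A(v₁,y))`. -/
noncomputable def wmul (A B : Wtwo F) : Wtwo F :=
  LinearMap.mk₂ F
    (fun x y => A (v1 F) (B x y) - B (A (v1 F) x) y - B x (A (v1 F) y))
    (fun x x' y => by simp only [map_add, LinearMap.add_apply]; abel)
    (fun c x y => by simp only [map_smul, LinearMap.smul_apply, smul_sub])
    (fun x y y' => by simp only [map_add, LinearMap.add_apply]; abel)
    (fun c x y => by simp only [map_smul, LinearMap.smul_apply, smul_sub])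

/-- The multiplication `α^k_{i,j}` determined by `α^k_{i,j}(v_t, v_l) = δ_{it} δ_{jl} v_k`
(indices `0, 1` correspond to `1, 2` in the paper). -/
noncomputable def alph (k i j : Fin 2) : Wtwo F :=
  LinearMap.mk₂ F
    (fun x y => (x i * y j) • (Pi.single k 1 : V2 F))
    (fun x x' y => by simp [add_mul, add_smul])
    (fun c x y => by simp [smul_smul, mul_assoc])
    (fun x y y' => by simp [mul_add, add_smul])
    (fun c x y => by simp [smul_smul]; ring_nf)

noncomputable def e1 (F : Type*) [Field F] : Wtwo F := alph 0 0 0 - alph 1 0 1 - alph 1 1 0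

noncomputable def e2 (F : Type*) [Field F] : Wtwo F := alph 1 0 0

noncomputable def e3 (F : Type*) [Field F] : Wtwo F := alph 1 1 1 - alph 0 0 1 - alph 0 1 0

noncomputable def e4 (F : Type*) [Field F] : Wtwo F := alph 0 1 1

noncomputable def e5 (F : Type*) [Field F] : Wtwo F := (2 : F) • alph 0 0 0 + alph 1 0 1 + alph 1 1 0

noncomputable def e6 (F : Type*) [Field F] : Wtwo F := (2 : F) • alph 1 1 1 + alph 0 0 1 + alph 0 1 0


/-- An automorphism of `W(2)`: a bijective linear map that is multiplicative. -/
def IsAutomorphism (φ : Wtwo F →ₗ[F] Wtwo F) : Prop :=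
  Function.Bijective φ ∧ ∀ x y : Wtwo F, φ (wmul x y) = wmul (φ x) (φ y)

/-- `S2` as a subspace of `W(2)`. -/
noncomputable def S2 (F : Type*) [Field F] : Submodule F (Wtwo F) :=
  Submodule.span F {e1 F, e2 F, e3 F, e4 F}

/-- `W2sub` as a subspace of `W(2)`. -/
noncomputable def W2sub (F : Type*) [Field F] : Submodule F (Wtwo F) :=
  Submodule.span F {e1 F, e2 F, e3 F, e4 F, e5 F, e6 F}

/-- Elements of `W(2)` are equal when their structure constants agree. -/
theorem wtwo_ext {A B : Wtwo F}
    (h : ∀ i j k, A (Pi.single i 1) (Pi.single j 1) k = B (Pi.single i 1) (Pi.single j 1) k) :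
    A = B := by
  refine LinearMap.pi_ext' fun i => LinearMap.ext_ring ?_
  refine LinearMap.pi_ext' fun j => LinearMap.ext_ring ?_
  funext k
  simpa using h i j k

/-- The structure constants of the Kantor product. -/
theorem wmul_apply_single (A B : Wtwo F) (i j k : Fin 2) :
    wmul A B (Pi.single i 1) (Pi.single j 1) k =
      ∑ m, (A (Pi.single 0 1) (Pi.single m 1) k * B (Pi.single i 1) (Pi.single j 1) m
        - A (Pi.single 0 1) (Pi.single i 1) m * B (Pi.single m 1) (Pi.single j 1) k
        - A (Pi.single 0 1) (Pi.single j 1) m * B (Pi.single i 1) (Pi.single m 1) k) := by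
  have expand : ∀ v : V2 F, v = v 0 • Pi.single 0 1 + v 1 • Pi.single 1 1 := fun v => by
    ext t; fin_cases t <;> simp
  have h₁ (v : V2 F) : A (v1 F) v k =
      v 0 * A (v1 F) (Pi.single 0 1) k + v 1 * A (v1 F) (Pi.single 1 1) k := by
    conv_lhs => rw [expand v]
    simp
  have h₂ (v w : V2 F) : B v w k =
      v 0 * B (Pi.single 0 1) w k + v 1 * B (Pi.single 1 1) w k := by
    conv_lhs => rw [expand v]
    simp
  have h₃ (v w : V2 F) : B v w k =
      w 0 * B v (Pi.single 0 1) k + w 1 * B v (Pi.single 1 1) k := by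
    conv_lhs => rw [expand w]
    simp
  simp only [wmul, LinearMap.mk₂_apply, Pi.sub_apply, Fin.sum_univ_two]
  rw [h₁ (B _ _), h₂ (A _ _), h₃ _ (A _ _)]
  simp only [v1]
  ring

theorem alph_apply_single (k i j s t l : Fin 2) :
    (alph k i j : Wtwo F) (Pi.single s 1) (Pi.single t 1) l =
      if i = s ∧ j = t ∧ k = l then 1 else 0 := by
  simp only [alph, LinearMap.mk₂_apply, Pi.smul_apply, Pi.single_apply, smul_eq_mul]
  split_ifs <;> simp_all

/-- `S₂` consists of the commutative multiplications all of whose multiplication operators are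
traceless. -/
theorem mem_S2_iff (A : Wtwo F) :
    A ∈ S2 F ↔
      A (Pi.single 0 1) (Pi.single 1 1) = A (Pi.single 1 1) (Pi.single 0 1) ∧
      ∀ i, A (Pi.single i 1) (Pi.single 0 1) 0 + A (Pi.single i 1) (Pi.single 1 1) 1 = 0 := by
  constructor
  · intro h
    induction h using Submodule.span_induction with
    | mem x hx =>
      simp only [Set.mem_insert_iff, Set.mem_singleton_iff] at hx
      rcases hx with rfl | rfl | rfl | rfl <;>
        simp [e1, e2, e3, e4, funext_iff, alph_apply_single]
    | zero => simp
    | add x y _ _ hx hy =>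
      refine ⟨by simp [hx.1, hy.1], fun i => ?_⟩
      simp only [LinearMap.add_apply, Pi.add_apply]
      linear_combination hx.2 i + hy.2 i
    | smul c x _ hx =>
      refine ⟨by simp [hx.1], fun i => ?_⟩
      simp only [LinearMap.smul_apply, Pi.smul_apply, smul_eq_mul]
      linear_combination c * hx.2 i
  · rintro ⟨hs, ht⟩
    have h0 := ht 0
    have h1 := ht 1
    have hs0 := congrFun hs 0
    have hs1 := congrFun hs 1
    have key : A = A (Pi.single 0 1) (Pi.single 0 1) 0 • e1 F
        + A (Pi.single 0 1) (Pi.single 0 1) 1 • e2 F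
        + A (Pi.single 1 1) (Pi.single 1 1) 1 • e3 F
        + A (Pi.single 1 1) (Pi.single 1 1) 0 • e4 F := by
      refine wtwo_ext fun i j k => ?_
      fin_cases i <;> fin_cases j <;> fin_cases k <;>
        simp [e1, e2, e3, e4, alph_apply_single] <;> grind
    rw [key]
    have mem {x} (hx : x ∈ ({e1 F, e2 F, e3 F, e4 F} : Set (Wtwo F))) (c : F) : c • x ∈ S2 F :=
      Submodule.smul_mem _ _ (Submodule.subset_span hx)
    refine add_mem (add_mem (add_mem ?_ ?_) ?_) ?_ <;> exact mem (by simp) _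

theorem S2_le_W2sub : S2 F ≤ W2sub F :=
  Submodule.span_mono fun x hx => by
    simp only [Set.mem_insert_iff, Set.mem_singleton_iff] at hx ⊢
    tauto

/-- `A` is left nilpotent when the fourth power of left multiplication by `A` vanishes. -/
def IsLeftNilpotent (A : Wtwo F) : Prop :=
  ∀ x, wmul A (wmul A (wmul A (wmul A x))) = 0

/-- The matrix of `A(v₁, ·)`. -/
def leftMatrix (A : Wtwo F) : Matrix (Fin 2) (Fin 2) F :=
  Matrix.of fun k m => A (Pi.single 0 1) (Pi.single m 1) k

/-- The multiplication `(x, y) ↦ f(x) y`. -/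
noncomputable def scalarMul (f : V2 F) : Wtwo F :=
  f 0 • (alph 0 0 0 + alph 1 0 1) + f 1 • (alph 0 1 0 + alph 1 1 1)

theorem wmul_scalarMul (A : Wtwo F) (f : V2 F) :
    wmul A (scalarMul f) = scalarMul (-(Matrix.vecMul f (leftMatrix A))) := by
  refine wtwo_ext fun i j k => ?_
  rw [wmul_apply_single]
  fin_cases i <;> fin_cases j <;> fin_cases k <;>
    simp [scalarMul, alph_apply_single, leftMatrix, Matrix.vecMul, dotProduct] <;> ring

theorem scalarMul_eq_zero {f : V2 F} (h : scalarMul f = 0) : f = 0 := by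
  ext i
  have := congrFun (LinearMap.congr_fun (LinearMap.congr_fun h (Pi.single i 1))
    (Pi.single 0 1)) 0
  fin_cases i <;> simpa [scalarMul, alph_apply_single] using this

theorem IsLeftNilpotent.isNilpotent_leftMatrix {A : Wtwo F} (h : IsLeftNilpotent A) :
    IsNilpotent (leftMatrix A) := by
  refine ⟨4, Matrix.ext_of_single_vecMul fun i => ?_⟩
  have := h (scalarMul (Pi.single i 1))
  simp only [wmul_scalarMul, Matrix.neg_vecMul, neg_neg, Matrix.vecMul_vecMul] at this
  rw [Matrix.vecMul_zero, ← scalarMul_eq_zero this]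
  simp only [pow_succ, pow_zero, one_mul]

theorem IsLeftNilpotent.trace_eq_zero {A : Wtwo F} (h : IsLeftNilpotent A) :
    A (Pi.single 0 1) (Pi.single 0 1) 0 + A (Pi.single 0 1) (Pi.single 1 1) 1 = 0 := by
  simpa [Matrix.trace, leftMatrix] using
    (Matrix.isNilpotent_trace_of_isNilpotent h.isNilpotent_leftMatrix).eq_zero

theorem IsLeftNilpotent.det_eq_zero {A : Wtwo F} (h : IsLeftNilpotent A) :
    A (Pi.single 0 1) (Pi.single 0 1) 0 * A (Pi.single 0 1) (Pi.single 1 1) 1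
      - A (Pi.single 0 1) (Pi.single 1 1) 0 * A (Pi.single 0 1) (Pi.single 0 1) 1 = 0 := by
  obtain ⟨n, hn⟩ := h.isNilpotent_leftMatrix
  have : (leftMatrix A).det = 0 := by
    refine eq_zero_of_pow_eq_zero (n := n) ?_
    rw [← Matrix.det_pow, hn, Matrix.det_zero]
  simpa [Matrix.det_fin_two, leftMatrix] using this

theorem IsLeftNilpotent.wmul_wmul_mem_S2 {A : Wtwo F} (h : IsLeftNilpotent A) (x : Wtwo F) :
    wmul A (wmul A x) ∈ S2 F := by
  have ht := h.trace_eq_zero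
  have hd := h.det_eq_zero
  rw [mem_S2_iff, funext_iff]
  simp only [wmul_apply_single, Fin.sum_univ_two, Fin.forall_fin_two]
  refine ⟨⟨?_, ?_⟩, ?_, ?_⟩ <;> grind

theorem wmul_alph_raising_apply_single (x : Wtwo F) (i j k : Fin 2) :
    wmul (alph 0 0 1) x (Pi.single i 1) (Pi.single j 1) k =
      (if k = 0 then x (Pi.single i 1) (Pi.single j 1) 1 else 0)
        - (if i = 1 then x (Pi.single 0 1) (Pi.single j 1) k else 0)
        - (if j = 1 then x (Pi.single i 1) (Pi.single 0 1) k else 0) := by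
  fin_cases i <;> fin_cases j <;> fin_cases k <;> simp [wmul_apply_single, alph_apply_single]

theorem wmul_alph_lowering_apply_single (x : Wtwo F) (i j k : Fin 2) :
    wmul (alph 1 0 0) x (Pi.single i 1) (Pi.single j 1) k =
      (if k = 1 then x (Pi.single i 1) (Pi.single j 1) 0 else 0)
        - (if i = 0 then x (Pi.single 1 1) (Pi.single j 1) k else 0)
        - (if j = 0 then x (Pi.single i 1) (Pi.single 1 1) k else 0) := by
  fin_cases i <;> fin_cases j <;> fin_cases k <;> simp [wmul_apply_single, alph_apply_single]

theorem isLeftNilpotent_alph_raising : IsLeftNilpotent (alph 0 0 1 : Wtwo F) := by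
  refine fun x => wtwo_ext fun i j k => ?_
  simp only [wmul_alph_raising_apply_single]
  fin_cases i <;> fin_cases j <;> fin_cases k <;> simp

theorem isLeftNilpotent_alph_lowering : IsLeftNilpotent (alph 1 0 0 : Wtwo F) := by
  refine fun x => wtwo_ext fun i j k => ?_
  simp only [wmul_alph_lowering_apply_single]
  fin_cases i <;> fin_cases j <;> fin_cases k <;> simp

/-- `x` is killed by the squares of the left multiplications by left nilpotent elements. -/
def IsDoublyAnnihilated (x : Wtwo F) : Prop :=
  ∀ A : Wtwo F, IsLeftNilpotent A → wmul A (wmul A x) = 0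

/-- `S₂` is generated by the elements `A·(A·x)` with `A` left nilpotent. -/
theorem S2_eq_span [CharZero F] :
    S2 F = Submodule.span F {y | ∃ A x, IsLeftNilpotent A ∧ wmul A (wmul A x) = y} := by
  apply le_antisymm
  · refine Submodule.span_le.mpr fun y hy => ?_
    simp only [Set.mem_insert_iff, Set.mem_singleton_iff] at hy
    rcases hy with rfl | rfl | rfl | rfl
    · refine Submodule.subset_span ⟨_, (2 : F)⁻¹ • e4 F, isLeftNilpotent_alph_lowering,
        wtwo_ext fun i j k => ?_⟩
      simp only [wmul_alph_lowering_apply_single]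
      fin_cases i <;> fin_cases j <;> fin_cases k <;>
        simp [e1, e4, alph_apply_single] <;> grind
    · refine Submodule.subset_span ⟨_, (6 : F)⁻¹ • e3 F, isLeftNilpotent_alph_lowering,
        wtwo_ext fun i j k => ?_⟩
      simp only [wmul_alph_lowering_apply_single]
      fin_cases i <;> fin_cases j <;> fin_cases k <;>
        simp [e2, e3, alph_apply_single] <;> grind
    · refine Submodule.subset_span ⟨_, (2 : F)⁻¹ • e2 F, isLeftNilpotent_alph_raising,
        wtwo_ext fun i j k => ?_⟩
      simp only [wmul_alph_raising_apply_single]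
      fin_cases i <;> fin_cases j <;> fin_cases k <;>
        simp [e2, e3, alph_apply_single] <;> grind
    · refine Submodule.subset_span ⟨_, (6 : F)⁻¹ • e1 F, isLeftNilpotent_alph_raising,
        wtwo_ext fun i j k => ?_⟩
      simp only [wmul_alph_raising_apply_single]
      fin_cases i <;> fin_cases j <;> fin_cases k <;>
        simp [e1, e4, alph_apply_single] <;> grind
  · refine Submodule.span_le.mpr ?_
    rintro _ ⟨A, x, hA, rfl⟩
    exact hA.wmul_wmul_mem_S2 x

theorem IsDoublyAnnihilated.apply_single [CharZero F] {x : Wtwo F} (h : IsDoublyAnnihilated x) :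
    x (Pi.single 0 1) (Pi.single 0 1) 1 = 0 ∧ x (Pi.single 1 1) (Pi.single 1 1) 0 = 0 ∧
    x (Pi.single 0 1) (Pi.single 0 1) 0 =
      x (Pi.single 0 1) (Pi.single 1 1) 1 + x (Pi.single 1 1) (Pi.single 0 1) 1 ∧
    x (Pi.single 1 1) (Pi.single 1 1) 1 =
      x (Pi.single 0 1) (Pi.single 1 1) 0 + x (Pi.single 1 1) (Pi.single 0 1) 0 := by
  have hr (i j k : Fin 2) := congrFun (LinearMap.congr_fun (LinearMap.congr_fun
    (h _ isLeftNilpotent_alph_raising) (Pi.single i 1)) (Pi.single j 1)) k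
  have hl (i j k : Fin 2) := congrFun (LinearMap.congr_fun (LinearMap.congr_fun
    (h _ isLeftNilpotent_alph_lowering) (Pi.single i 1)) (Pi.single j 1)) k
  simp only [wmul_alph_raising_apply_single, wmul_alph_lowering_apply_single,
    Fin.forall_fin_two] at hr hl
  simp at hr hl
  grind

theorem isDoublyAnnihilated_e5 : IsDoublyAnnihilated (e5 F) := by
  intro A hA
  have ht := hA.trace_eq_zero
  have hd := hA.det_eq_zero
  refine wtwo_ext fun i j k => ?_
  simp only [wmul_apply_single, Fin.sum_univ_two]
  fin_cases i <;> fin_cases j <;> fin_cases k <;> simp [e5, alph_apply_single] <;> grind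

theorem isDoublyAnnihilated_e6 : IsDoublyAnnihilated (e6 F) := by
  intro A hA
  have ht := hA.trace_eq_zero
  have hd := hA.det_eq_zero
  refine wtwo_ext fun i j k => ?_
  simp only [wmul_apply_single, Fin.sum_univ_two]
  fin_cases i <;> fin_cases j <;> fin_cases k <;> simp [e6, alph_apply_single] <;> grind

theorem isLeftNilpotent_e6 : IsLeftNilpotent (e6 F) := by
  have h (x : Wtwo F) : wmul (e6 F) x = wmul (alph 0 0 1) x := by
    refine wtwo_ext fun i j k => ?_
    simp [wmul_apply_single, e6, alph_apply_single]
  intro x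
  simp only [h, isLeftNilpotent_alph_raising x]

theorem wmul_e5_e5 : wmul (e5 F) (e5 F) = (-2 : F) • e5 F := by
  refine wtwo_ext fun i j k => ?_
  fin_cases i <;> fin_cases j <;> fin_cases k <;>
    simp [wmul_apply_single, e5, alph_apply_single]

theorem wmul_e5_e6 : wmul (e5 F) (e6 F) = (-1 : F) • e6 F := by
  refine wtwo_ext fun i j k => ?_
  fin_cases i <;> fin_cases j <;> fin_cases k <;>
    simp [wmul_apply_single, e5, e6, alph_apply_single]

theorem wmul_e6_e5 : wmul (e6 F) (e5 F) = (-1 : F) • e6 F := by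
  refine wtwo_ext fun i j k => ?_
  fin_cases i <;> fin_cases j <;> fin_cases k <;>
    simp [wmul_apply_single, e5, e6, alph_apply_single] <;> norm_num

theorem e6_ne_zero : e6 F ≠ 0 := fun h => by
  have := congrFun (LinearMap.congr_fun (LinearMap.congr_fun h (Pi.single 0 1))
    (Pi.single 1 1)) 0
  simp [e6, alph_apply_single] at this

/-- `W₂` contains every commutative multiplication. -/
theorem mem_W2sub_of_comm [CharZero F] {A : Wtwo F}
    (h : A (Pi.single 0 1) (Pi.single 1 1) = A (Pi.single 1 1) (Pi.single 0 1)) :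
    A ∈ W2sub F := by
  set a := A (Pi.single 0 1) (Pi.single 0 1) 0
  set b := A (Pi.single 0 1) (Pi.single 1 1) 1
  set c := A (Pi.single 1 1) (Pi.single 1 1) 1
  set d := A (Pi.single 0 1) (Pi.single 1 1) 0
  have hs0 := congrFun h 0
  have hs1 := congrFun h 1
  have key : A = ((a - 2 * b) / 3) • e1 F + A (Pi.single 0 1) (Pi.single 0 1) 1 • e2 F
      + ((c - 2 * d) / 3) • e3 F + A (Pi.single 1 1) (Pi.single 1 1) 0 • e4 F
      + ((a + b) / 3) • e5 F + ((c + d) / 3) • e6 F := by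
    refine wtwo_ext fun i j k => ?_
    fin_cases i <;> fin_cases j <;> fin_cases k <;>
      simp [e1, e2, e3, e4, e5, e6, alph_apply_single] <;> grind
  rw [key]
  have mem {x} (hx : x ∈ ({e1 F, e2 F, e3 F, e4 F, e5 F, e6 F} : Set (Wtwo F))) (r : F) :
      r • x ∈ W2sub F :=
    Submodule.smul_mem _ _ (Submodule.subset_span hx)
  refine add_mem (add_mem (add_mem (add_mem (add_mem ?_ ?_) ?_) ?_) ?_) ?_ <;>
    exact mem (by simp) _

/-- Doubly annihilated elements satisfying the multiplication table of `e₅, e₆` are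
commutative. -/
theorem comm_of_mul_table [CharZero F] {X Y : Wtwo F} (hX : IsDoublyAnnihilated X)
    (hY : IsDoublyAnnihilated Y) (hYnil : IsLeftNilpotent Y) (hY0 : Y ≠ 0)
    (hXX : wmul X X = (-2 : F) • X) (hXY : wmul X Y = (-1 : F) • Y)
    (hYX : wmul Y X = (-1 : F) • Y) :
    X (Pi.single 0 1) (Pi.single 1 1) = X (Pi.single 1 1) (Pi.single 0 1) ∧
      Y (Pi.single 0 1) (Pi.single 1 1) = Y (Pi.single 1 1) (Pi.single 0 1) := by
  obtain ⟨hX1, hX2, hX3, hX4⟩ := hX.apply_single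
  obtain ⟨hY1, hY2, hY3, hY4⟩ := hY.apply_single
  have ht := hYnil.trace_eq_zero
  have hd := hYnil.det_eq_zero
  have entry {A B : Wtwo F} (h : A = B) (i j k : Fin 2) :
      A (Pi.single i 1) (Pi.single j 1) k = B (Pi.single i 1) (Pi.single j 1) k := by rw [h]
  have hXX' := entry hXX
  have hXY' := entry hXY
  have hYX' := entry hYX
  clear entry
  simp only [wmul_apply_single, Fin.sum_univ_two, Fin.forall_fin_two, LinearMap.smul_apply,
    Pi.smul_apply, smul_eq_mul, hX1, hX2, hX3, hX4, hY1, hY2, hY3, hY4] at hXX' hXY' hYX' ht hd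
  have hY011 : Y (Pi.single 0 1) (Pi.single 1 1) 1 = 0 := by
    refine pow_eq_zero_iff (two_ne_zero) |>.mp ?_
    grind
  have hY101 : Y (Pi.single 1 1) (Pi.single 0 1) 1 = 0 := by grind
  have hne : Y (Pi.single 0 1) (Pi.single 1 1) 0 ≠ 0 ∨
      Y (Pi.single 1 1) (Pi.single 0 1) 0 ≠ 0 := by
    by_contra! hc
    refine hY0 (wtwo_ext fun i j k => ?_)
    fin_cases i <;> fin_cases j <;> fin_cases k <;>
      simp [hY1, hY2, hY3, hY4, hY011, hY101, hc]
  simp only [hY011, hY101] at hXX' hXY' hYX'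
  have hX011 : X (Pi.single 0 1) (Pi.single 1 1) 1 = 1 := by
    rcases hne with h | h <;> refine mul_left_cancel₀ h ?_ <;> grind
  have hYs : Y (Pi.single 0 1) (Pi.single 1 1) 0 = Y (Pi.single 1 1) (Pi.single 0 1) 0 := by
    grind
  refine ⟨?_, ?_⟩ <;> simp only [funext_iff, Fin.forall_fin_two] <;> constructor <;> grind

theorem IsAutomorphism.isLeftNilpotent_iff {φ : Wtwo F →ₗ[F] Wtwo F} (hφ : IsAutomorphism φ)
    {A : Wtwo F} : IsLeftNilpotent (φ A) ↔ IsLeftNilpotent A := by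
  obtain ⟨hbij, hmul⟩ := hφ
  rw [IsLeftNilpotent, hbij.surjective.forall]
  simp only [← hmul, map_eq_zero_iff φ hbij.injective, IsLeftNilpotent]

theorem IsAutomorphism.isDoublyAnnihilated {φ : Wtwo F →ₗ[F] Wtwo F} (hφ : IsAutomorphism φ)
    {x : Wtwo F} (hx : IsDoublyAnnihilated x) : IsDoublyAnnihilated (φ x) := by
  rw [IsDoublyAnnihilated, hφ.1.surjective.forall]
  intro A hA
  rw [← hφ.2, ← hφ.2, hx A (hφ.isLeftNilpotent_iff.mp hA), map_zero]

theorem IsAutomorphism.map_mem_S2 [CharZero F] {φ : Wtwo F →ₗ[F] Wtwo F} (hφ : IsAutomorphism φ)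
    {x : Wtwo F} (hx : x ∈ S2 F) : φ x ∈ S2 F := by
  suffices S2 F ≤ (S2 F).comap φ from this hx
  conv_lhs => rw [S2_eq_span]
  refine Submodule.span_le.mpr ?_
  rintro _ ⟨A, y, hA, rfl⟩
  simp only [Submodule.comap_coe, Set.mem_preimage, SetLike.mem_coe, hφ.2]
  exact (hφ.isLeftNilpotent_iff.mpr hA).wmul_wmul_mem_S2 _

/-- Every automorphism of `W(2)` leaves the subspaces `S₂` and `W₂` invariant. -/
theorem automorphism_invariant_subspaces {F : Type*} [Field F] [CharZero F]
    (φ : Wtwo F →ₗ[F] Wtwo F) (hφ : IsAutomorphism φ) :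
    (∀ x ∈ S2 F, φ x ∈ S2 F) ∧ (∀ x ∈ W2sub F, φ x ∈ W2sub F) := by
  refine ⟨fun x hx => hφ.map_mem_S2 hx, fun x hx => ?_⟩
  suffices W2sub F ≤ (W2sub F).comap φ from this hx
  have hcomm := comm_of_mul_table (hφ.isDoublyAnnihilated isDoublyAnnihilated_e5)
    (hφ.isDoublyAnnihilated isDoublyAnnihilated_e6)
    (hφ.isLeftNilpotent_iff.mpr isLeftNilpotent_e6)
    ((map_ne_zero_iff φ hφ.1.injective).mpr e6_ne_zero)
    (by rw [← hφ.2, wmul_e5_e5, map_smul]) (by rw [← hφ.2, wmul_e5_e6, map_smul])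
    (by rw [← hφ.2, wmul_e6_e5, map_smul])
  have hS {y : Wtwo F} (hy : y ∈ ({e1 F, e2 F, e3 F, e4 F} : Set (Wtwo F))) :
      φ y ∈ W2sub F :=
    S2_le_W2sub (hφ.map_mem_S2 (Submodule.subset_span hy))
  refine Submodule.span_le.mpr fun y hy => ?_
  simp only [Set.mem_insert_iff, Set.mem_singleton_iff] at hy
  rcases hy with rfl | rfl | rfl | rfl | rfl | rfl
  · exact hS (by simp)
  · exact hS (by simp)
  · exact hS (by simp)
  · exact hS (by simp)
  · exact mem_W2sub_of_comm hcomm.1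
  · exact mem_W2sub_of_comm hcomm.2
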